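/- Let x, y, z be pairwise coprime positive integers with xyz ≠ 0, and let p, q, r be integers with pq ≠ 0. Then x^{2+ip} + y^{2+iq} ≠ z^{2+ir} (as complex numbers, where n^{2+ip} = exp((2+ip)·log n)). -/

import Mathlib

open Complex

namespace GaussianInt

/-- The `ℓ¹` norm of the coordinates of a Gaussian integer. -/
def l1Norm (x : GaussianInt) : ℝ := |(x.re : ℝ)| + |(x.im : ℝ)|

theorem l1Norm_nonneg (x : GaussianInt) : 0 ≤ l1Norm x := by
  unfold l1Norm; positivity

theorem l1Norm_add_le (x y : GaussianInt) : l1Norm (x + y) ≤ l1Norm x + l1Norm y := by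
  simp only [l1Norm, Zsqrtd.re_add, Zsqrtd.im_add, Int.cast_add]
  linarith [abs_add_le (x.re : ℝ) y.re, abs_add_le (x.im : ℝ) y.im]

theorem l1Norm_mul_le (x y : GaussianInt) : l1Norm (x * y) ≤ l1Norm x * l1Norm y := by
  simp only [l1Norm, Zsqrtd.re_mul, Zsqrtd.im_mul]
  push_cast
  have h₁ := abs_add_le ((x.re : ℝ) * y.re) (-1 * x.im * y.im)
  have h₂ := abs_add_le ((x.re : ℝ) * y.im) (x.im * y.re)
  simp only [abs_mul, abs_neg, abs_one] at h₁ h₂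
  linarith

@[simp]
theorem l1Norm_one : l1Norm 1 = 1 := by simp [l1Norm]

theorem l1Norm_pow_le (x : GaussianInt) (n : ℕ) : l1Norm (x ^ n) ≤ l1Norm x ^ n := by
  induction n with
  | zero => simp
  | succ n ih =>
    rw [pow_succ, pow_succ]
    exact (l1Norm_mul_le _ _).trans (mul_le_mul_of_nonneg_right ih (l1Norm_nonneg x))

theorem norm_toComplex_le (x : GaussianInt) : ‖(x : ℂ)‖ ≤ l1Norm x := by
  simpa [l1Norm, ← intCast_re, ← intCast_im] using Complex.norm_le_abs_re_add_abs_im (x : ℂ)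

theorem one_le_norm_toComplex {x : GaussianInt} (hx : x ≠ 0) : 1 ≤ ‖(x : ℂ)‖ := by
  have h : (1 : ℝ) ≤ x.norm := by exact_mod_cast norm_pos.2 hx
  rw [intCast_real_norm, Complex.normSq_eq_norm_sq] at h
  exact (one_le_sq_iff₀ (_root_.norm_nonneg _)).1 h

theorem one_le_l1Norm {x : GaussianInt} (hx : x ≠ 0) : 1 ≤ l1Norm x :=
  (one_le_norm_toComplex hx).trans (norm_toComplex_le x)

end GaussianInt

namespace QuadraticAlgebra

open GaussianInt

variable {a b : GaussianInt}

/-- The `ℓ¹` norm of the coordinates of an element of a quadratic algebra over `ℤ[i]`. -/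
def l1Norm (v : QuadraticAlgebra GaussianInt a b) : ℝ := v.re.l1Norm + v.im.l1Norm

theorem l1Norm_nonneg (v : QuadraticAlgebra GaussianInt a b) : 0 ≤ l1Norm v :=
  add_nonneg (GaussianInt.l1Norm_nonneg _) (GaussianInt.l1Norm_nonneg _)

theorem l1Norm_add_le (v w : QuadraticAlgebra GaussianInt a b) :
    l1Norm (v + w) ≤ l1Norm v + l1Norm w := by
  have h₁ := GaussianInt.l1Norm_add_le v.re w.re
  have h₂ := GaussianInt.l1Norm_add_le v.im w.im
  simp only [l1Norm, re_add, im_add]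
  linarith

theorem l1Norm_sum_le {ι : Type*} (s : Finset ι) (f : ι → QuadraticAlgebra GaussianInt a b) :
    l1Norm (∑ i ∈ s, f i) ≤ ∑ i ∈ s, l1Norm (f i) :=
  Finset.le_sum_of_subadditive _ (by simp [l1Norm, GaussianInt.l1Norm]) l1Norm_add_le _ _

theorem l1Norm_smul_le (g : GaussianInt) (v : QuadraticAlgebra GaussianInt a b) :
    l1Norm (g • v) ≤ g.l1Norm * l1Norm v := by
  simp only [l1Norm, re_smul, im_smul, smul_eq_mul, mul_add]
  exact add_le_add (GaussianInt.l1Norm_mul_le _ _) (GaussianInt.l1Norm_mul_le _ _)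

theorem l1Norm_zsmul (n : ℤ) (v : QuadraticAlgebra GaussianInt a b) :
    l1Norm (n • v) = |(n : ℝ)| * l1Norm v := by
  simp [l1Norm, GaussianInt.l1Norm, abs_mul, mul_add]

theorem l1Norm_omega_pow_le (n : ℕ) :
    l1Norm ((omega : QuadraticAlgebra GaussianInt a b) ^ n) ≤ (1 + a.l1Norm + b.l1Norm) ^ n := by
  induction n with
  | zero => simp [l1Norm, GaussianInt.l1Norm]
  | succ n ih =>
    rw [pow_succ', pow_succ']
    generalize (omega : QuadraticAlgebra GaussianInt a b) ^ n = v at ih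
    have hv : l1Norm (omega * v) ≤ (1 + a.l1Norm + b.l1Norm) * l1Norm v := by
      obtain ⟨x, y⟩ := v
      rw [omega_mul_mk]
      have h₁ := GaussianInt.l1Norm_mul_le a y
      have h₂ := GaussianInt.l1Norm_mul_le b y
      have h₃ := GaussianInt.l1Norm_add_le x (b * y)
      have hx := GaussianInt.l1Norm_nonneg x
      have ha := GaussianInt.l1Norm_nonneg a
      have hb := GaussianInt.l1Norm_nonneg b
      simp only [l1Norm]
      nlinarith [GaussianInt.l1Norm_nonneg y]
    exact hv.trans (mul_le_mul_of_nonneg_left ih (by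
      have ha := GaussianInt.l1Norm_nonneg a
      have hb := GaussianInt.l1Norm_nonneg b
      positivity))

theorem one_le_l1Norm {v : QuadraticAlgebra GaussianInt a b} (hv : v ≠ 0) : 1 ≤ l1Norm v := by
  have hre := GaussianInt.l1Norm_nonneg v.re
  have him := GaussianInt.l1Norm_nonneg v.im
  unfold l1Norm
  by_cases h : v.re = 0
  · have h' : v.im ≠ 0 := fun h' => hv (QuadraticAlgebra.ext h h')
    linarith [GaussianInt.one_le_l1Norm h']
  · linarith [GaussianInt.one_le_l1Norm h]

/-- Evaluation of an element of a quadratic algebra over `ℤ[i]` at a complex root `σ` of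
the defining polynomial `X ^ 2 - b X - a`. -/
noncomputable def evalComplex (σ : ℂ) (hσ : σ * σ = a + b * σ) :
    QuadraticAlgebra GaussianInt a b →+* ℂ where
  toFun v := v.re + v.im * σ
  map_one' := by simp
  map_zero' := by simp
  map_add' v w := by simp; ring
  map_mul' v w := by simp; linear_combination -(v.im * w.im : ℂ) * hσ

variable {σ : ℂ} (hσ : σ * σ = a + b * σ)

theorem evalComplex_apply (v : QuadraticAlgebra GaussianInt a b) :
    evalComplex σ hσ v = v.re + v.im * σ := rfl

theorem evalComplex_smul (g : GaussianInt) (v : QuadraticAlgebra GaussianInt a b) :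
    evalComplex σ hσ (g • v) = g * evalComplex σ hσ v := by
  simp [evalComplex_apply]; ring

@[simp]
theorem evalComplex_omega : evalComplex σ hσ omega = σ := by simp [evalComplex_apply]

/-- Liouville's inequality. -/
theorem exists_pos_le_norm_evalComplex_mul_l1Norm :
    ∃ c : ℝ, 0 < c ∧ ∀ v : QuadraticAlgebra GaussianInt a b, evalComplex σ hσ v ≠ 0 →
      c ≤ ‖evalComplex σ hσ v‖ * l1Norm v := by
  obtain ⟨δ, hδ, hδ'⟩ : ∃ δ : ℝ, 0 < δ ∧ (2 * σ - b ≠ 0 → δ ≤ ‖2 * σ - b‖) := by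
    by_cases h : 2 * σ - b = 0
    · exact ⟨1, one_pos, fun h' => absurd h h'⟩
    · exact ⟨_, norm_pos_iff.2 h, fun _ => le_rfl⟩
  have hK : 0 < 1 + b.l1Norm + ‖σ‖ := by
    have := GaussianInt.l1Norm_nonneg b
    positivity
  refine ⟨min δ (1 + b.l1Norm + ‖σ‖)⁻¹, by positivity, fun v hv => ?_⟩
  have hv1 : 1 ≤ l1Norm v := one_le_l1Norm (by rintro rfl; simp at hv)
  have hstar : evalComplex σ hσ (star v) = v.re + v.im * (b - σ) := by
    simp [evalComplex_apply]; ring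
  have hmul : evalComplex σ hσ v * evalComplex σ hσ (star v) = (norm v : GaussianInt) := by
    rw [← map_mul, ← algebraMap_norm_eq_mul_star]
    simp [evalComplex_apply]
  by_cases hn : norm v = 0
  · have h0 : evalComplex σ hσ (star v) = 0 := by simpa [hn, hv] using hmul
    have hval : evalComplex σ hσ v = v.im * (2 * σ - b) := by
      rw [hstar] at h0
      rw [evalComplex_apply]
      linear_combination h0
    rw [hval] at hv ⊢
    have him : v.im ≠ 0 := by intro h; simp [h] at hv
    have h₁ := one_le_norm_toComplex him
    have h₂ := hδ' (right_ne_zero_of_mul hv)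
    rw [norm_mul]
    calc _ ≤ 1 * δ * 1 := by simp
      _ ≤ _ := by gcongr
  · have h₁ := one_le_norm_toComplex hn
    rw [← hmul, norm_mul] at h₁
    have h₂ : ‖evalComplex σ hσ (star v)‖ ≤ (1 + b.l1Norm + ‖σ‖) * l1Norm v := by
      rw [hstar]
      have e₁ := norm_toComplex_le v.re
      have e₂ := norm_toComplex_le v.im
      have e₃ := norm_toComplex_le b
      have e₄ := GaussianInt.l1Norm_nonneg v.re
      have e₅ := GaussianInt.l1Norm_nonneg b
      have e₆ := GaussianInt.l1Norm_nonneg v.im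
      calc _ ≤ ‖(v.re : ℂ)‖ + ‖(v.im : ℂ)‖ * (‖(b : ℂ)‖ + ‖σ‖) := by
            refine (norm_add_le _ _).trans ?_
            rw [norm_mul]
            gcongr
            exact norm_sub_le _ _
        _ ≤ v.re.l1Norm + v.im.l1Norm * (b.l1Norm + ‖σ‖) := by gcongr
        _ ≤ _ := by
          have h₇ : 0 ≤ v.re.l1Norm * (b.l1Norm + ‖σ‖) := by positivity
          unfold l1Norm
          linarith
    calc _ ≤ (1 + b.l1Norm + ‖σ‖)⁻¹ := min_le_right _ _
      _ ≤ (1 + b.l1Norm + ‖σ‖)⁻¹ *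
          (‖evalComplex σ hσ v‖ * ((1 + b.l1Norm + ‖σ‖) * l1Norm v)) := by
        refine le_mul_of_one_le_right (by positivity) (h₁.trans ?_)
        gcongr
      _ = _ := by field_simp

section Siegel

attribute [local instance] Matrix.seminormedAddCommGroup

/-- Siegel's lemma for linear systems with coefficients in a quadratic algebra over `ℤ[i]`. -/
theorem exists_ne_zero_sum_zsmul_eq_zero {ι κ : Type*} [Fintype ι] [Fintype κ] [Nonempty κ]
    (x : κ → ι → QuadraticAlgebra GaussianInt a b) {T : ℝ} (hT : 1 ≤ T)
    (hx : ∀ j i, l1Norm (x j i) ≤ T) (hcard : Fintype.card ι = 8 * Fintype.card κ) :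
    ∃ c : ι → ℤ, c ≠ 0 ∧ (∀ j, ∑ i, c i • x j i = 0) ∧
      ∀ i, |(c i : ℝ)| ≤ Fintype.card ι * T := by
  let coord : Fin 4 → QuadraticAlgebra GaussianInt a b →+ ℤ :=
    ![⟨⟨fun v => v.re.re, rfl⟩, fun _ _ => rfl⟩, ⟨⟨fun v => v.re.im, rfl⟩, fun _ _ => rfl⟩,
      ⟨⟨fun v => v.im.re, rfl⟩, fun _ _ => rfl⟩, ⟨⟨fun v => v.im.im, rfl⟩, fun _ _ => rfl⟩]
  have hcoord (k : Fin 4) (v : QuadraticAlgebra GaussianInt a b) :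
      |(coord k v : ℝ)| ≤ l1Norm v := by
    have h₁ := abs_nonneg (v.re.re : ℝ)
    have h₂ := abs_nonneg (v.re.im : ℝ)
    have h₃ := abs_nonneg (v.im.re : ℝ)
    have h₄ := abs_nonneg (v.im.im : ℝ)
    have h (k) : coord k v = ![v.re.re, v.re.im, v.im.re, v.im.im] k := by fin_cases k <;> rfl
    rw [h]
    unfold l1Norm GaussianInt.l1Norm
    fin_cases k <;> simp only [Fin.reduceFinMk, Matrix.cons_val] <;> linarith
  have hzero (v : QuadraticAlgebra GaussianInt a b) (hv : ∀ k, coord k v = 0) : v = 0 :=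
    QuadraticAlgebra.ext (Zsqrtd.ext (hv 0) (hv 1)) (Zsqrtd.ext (hv 2) (hv 3))
  let A : Matrix (κ × Fin 4) ι ℤ := fun j i => coord j.2 (x j.1 i)
  have hκ : 0 < Fintype.card κ := Fintype.card_pos
  obtain ⟨c, hc, hAc, hbound⟩ := Int.Matrix.exists_ne_zero_int_vec_norm_le A
    (by simp; omega) (by simpa using hκ)
  refine ⟨c, hc, fun j => hzero _ fun k => ?_, fun i => ?_⟩
  · have := congrFun hAc (j, k)
    simpa only [Matrix.mulVec, dotProduct, A, map_sum, map_zsmul, smul_eq_mul, mul_comm] using! this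
  · have hexp : ((Fintype.card (κ × Fin 4) : ℕ) : ℝ) /
        ((Fintype.card ι : ℝ) - (Fintype.card (κ × Fin 4) : ℕ)) = 1 := by
      rw [hcard]
      simp only [Fintype.card_prod, Fintype.card_fin]
      push_cast
      have : (0 : ℝ) < Fintype.card κ := by exact_mod_cast hκ
      field_simp
      norm_num
    rw [hexp, Real.rpow_one] at hbound
    have hA : ‖A‖ ≤ T := by
      rw [Matrix.norm_le_iff (by linarith)]
      intro j i
      rw [Int.norm_eq_abs]
      exact (hcoord _ _).trans (hx _ _)
    calc |(c i : ℝ)| = ‖c i‖ := (Int.norm_eq_abs _).symm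
      _ ≤ ‖c‖ := norm_le_pi_norm c i
      _ ≤ _ := hbound
      _ ≤ _ := by gcongr; exact max_le hT hA

end Siegel

end QuadraticAlgebra
namespace Complex

theorem exists_differentiable_eq_pow_mul {f : ℂ → ℂ} (hf : Differentiable ℂ f) {c : ℂ} {n : ℕ}
    (hn : n ≤ analyticOrderAt f c) :
    ∃ g : ℂ → ℂ, Differentiable ℂ g ∧ ∀ u, f u = (u - c) ^ n * g u := by
  obtain ⟨h, hh, hfh⟩ := (natCast_le_analyticOrderAt (hf.analyticAt c)).1 hn
  have hfc := hfh.self_of_nhds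
  classical
  let g : ℂ → ℂ := Function.update (fun u => f u / (u - c) ^ n) c (h c)
  have hg (u : ℂ) (hu : u ≠ c) : g u = f u / (u - c) ^ n := Function.update_of_ne hu _ _
  have hgc : g c = h c := Function.update_self _ _ _
  refine ⟨g, fun u => ?_, fun u => ?_⟩
  · rcases eq_or_ne u c with rfl | hu
    · refine hh.differentiableAt.congr_of_eventuallyEq ?_
      filter_upwards [hfh] with w hw
      rcases eq_or_ne w u with rfl | hwu
      · exact hgc
      · have : (w - u) ^ n ≠ 0 := pow_ne_zero _ (sub_ne_zero.2 hwu)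
        rw [hg w hwu, hw, smul_eq_mul, mul_div_cancel_left₀ _ this]
    · have hu' : (u - c) ^ n ≠ 0 := pow_ne_zero _ (sub_ne_zero.2 hu)
      have : DifferentiableAt ℂ (fun u => f u / (u - c) ^ n) u :=
        (hf u).div (by fun_prop) hu'
      refine this.congr_of_eventuallyEq ?_
      filter_upwards [isOpen_ne.mem_nhds hu] with w hw using hg w hw
  · rcases eq_or_ne u c with rfl | hu
    · rw [hgc]; simpa using hfc
    · have : (u - c) ^ n ≠ 0 := pow_ne_zero _ (sub_ne_zero.2 hu)
      rw [hg u hu, mul_div_cancel₀ _ this]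

theorem exists_differentiable_eq_prod_pow_mul {f : ℂ → ℂ} (hf : Differentiable ℂ f) {n : ℕ}
    (s : Finset ℂ) (hs : ∀ c ∈ s, n ≤ analyticOrderAt f c) :
    ∃ g : ℂ → ℂ, Differentiable ℂ g ∧ ∀ u, f u = (∏ c ∈ s, (u - c) ^ n) * g u := by
  classical
  induction s using Finset.induction_on generalizing f with
  | empty => exact ⟨f, hf, by simp⟩
  | insert c s hc ih =>
    obtain ⟨g, hg, hfg⟩ := exists_differentiable_eq_pow_mul hf (hs c (by simp))
    obtain ⟨h, hh, hgh⟩ := ih hg fun c' hc' => by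
      have hne : c' ≠ c := by rintro rfl; exact hc hc'
      have hp : AnalyticAt ℂ (fun u : ℂ => (u - c) ^ n) c' := by fun_prop
      have h0 : analyticOrderAt (fun u : ℂ => (u - c) ^ n) c' = 0 :=
        hp.analyticOrderAt_eq_zero.2 (pow_ne_zero _ (sub_ne_zero.2 hne))
      have hfun : f = (fun u => (u - c) ^ n) * g := funext hfg
      have hle := hs c' (by simp [hc'])
      rwa [hfun, analyticOrderAt_mul hp (hg.analyticAt c'), h0, zero_add] at hle
    exact ⟨h, hh, fun u => by rw [hfg, hgh, Finset.prod_insert hc, mul_assoc]⟩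

/-- A Schwarz lemma: an entire function with zeros of order `n` at `0, …, J - 1` has small `n`-th
derivatives at these points. -/
theorem norm_iteratedDeriv_le_of_forall_iteratedDeriv_eq_zero {f : ℂ → ℂ}
    (hf : Differentiable ℂ f) {J n : ℕ}
    (hzero : ∀ t < J, ∀ i < n, iteratedDeriv i f (t : ℂ) = 0) {R C : ℝ} (hR : J < R)
    (hC : ∀ u : ℂ, ‖u‖ = R → ‖f u‖ ≤ C) {t : ℕ} (ht : t < J) :
    ‖iteratedDeriv n f (t : ℂ)‖ ≤ n.factorial * ((2 * J / (R - J)) ^ (J * n) * C) := by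
  classical
  let s : Finset ℂ := (Finset.range J).map ⟨((↑) : ℕ → ℂ), Nat.cast_injective⟩
  have hprod (u : ℂ) : ‖∏ c ∈ s, (u - c) ^ n‖ = ∏ i ∈ Finset.range J, ‖u - i‖ ^ n := by
    simp [s]
  obtain ⟨g, hg, hfg⟩ := exists_differentiable_eq_prod_pow_mul hf (n := n) s (by
    simp only [s, Finset.mem_map, Finset.mem_range, Function.Embedding.coeFn_mk]
    rintro _ ⟨t, ht, rfl⟩
    exact (natCast_le_analyticOrderAt_iff_iteratedDeriv_eq_zero (hf.analyticAt _)).2 (hzero t ht))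
  have hJR : 0 < R - J := by linarith
  have hR0 : 0 < R := (Nat.cast_nonneg J).trans_lt hR
  have hJ : (t : ℝ) + 1 ≤ J := by exact_mod_cast ht
  have hgR (u : ℂ) (hu : ‖u‖ = R) : ‖g u‖ ≤ C / (R - J) ^ (J * n) := by
    rw [le_div_iff₀ (by positivity)]
    refine le_trans ?_ (hC u hu)
    rw [hfg, norm_mul, mul_comm, hprod]
    gcongr
    calc (R - J) ^ (J * n) = ∏ i ∈ Finset.range J, (R - J) ^ n := by
          rw [Finset.prod_const, Finset.card_range, ← pow_mul, mul_comm]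
      _ ≤ _ := by
        refine Finset.prod_le_prod (fun _ _ => by positivity) fun i hi => ?_
        have hi' : (i : ℝ) ≤ J := by exact_mod_cast (Finset.mem_range.1 hi).le
        have := norm_sub_norm_le u i
        rw [norm_natCast, hu] at this
        gcongr
        linarith
  have hgball (u : ℂ) (hu : ‖u‖ ≤ R) : ‖g u‖ ≤ C / (R - J) ^ (J * n) := by
    refine norm_le_of_forall_mem_frontier_norm_le (Metric.isBounded_ball (x := 0) (r := R))
      hg.diffContOnCl (fun w hw => hgR w ?_) ?_
    · simpa [frontier_ball _ hR0.ne'] using hw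
    · simpa [closure_ball _ hR0.ne'] using hu
  have hbound (u : ℂ) (hu : u ∈ Metric.sphere (t : ℂ) 1) :
      ‖f u‖ ≤ (2 * J / (R - J)) ^ (J * n) * C := by
    have hut : ‖u - t‖ = 1 := by simpa [dist_eq_norm] using hu
    have huJ : ‖u‖ ≤ J := by
      have := norm_sub_norm_le u t
      rw [norm_natCast, hut] at this
      linarith
    have hpr : ∏ i ∈ Finset.range J, ‖u - i‖ ^ n ≤ (2 * J : ℝ) ^ (J * n) := by
      calc _ ≤ ∏ i ∈ Finset.range J, (2 * J : ℝ) ^ n := by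
            refine Finset.prod_le_prod (fun _ _ => by positivity) fun i hi => ?_
            have hi' : (i : ℝ) ≤ J := by exact_mod_cast (Finset.mem_range.1 hi).le
            have := norm_sub_le u i
            rw [norm_natCast] at this
            gcongr
            linarith
        _ = _ := by rw [Finset.prod_const, Finset.card_range, ← pow_mul, mul_comm n]
    rw [hfg, norm_mul, hprod]
    calc _ ≤ (2 * J : ℝ) ^ (J * n) * (C / (R - J) ^ (J * n)) := by
          gcongr
          exact hgball u (huJ.trans hR.le)
      _ = _ := by rw [div_pow, div_mul_eq_mul_div, mul_div_assoc]
  simpa [mul_div_assoc] using norm_iteratedDeriv_le_of_forall_mem_sphere_norm_le n one_pos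
    hf.diffContOnCl hbound

end Complex

theorem eq_zero_of_forall_sum_mul_pow_eq_zero {R ι : Type*} [CommRing R] [IsDomain R] [Fintype ι]
    {w c : ι → R} (hw : Function.Injective w) (h : ∀ n : ℕ, ∑ i, c i * w i ^ n = 0) : c = 0 := by
  let e := Fintype.equivFin ι
  have := Matrix.eq_zero_of_forall_pow_sum_mul_pow_eq_zero (f := w ∘ e.symm) (v := c ∘ e.symm)
    (hw.comp e.symm.injective) fun n => by
      simpa using (Equiv.sum_comp e.symm fun i => c i * w i ^ (n : ℕ)).trans (h n)
  funext i
  simpa using congrFun this (e i)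
theorem exists_nat_forall_mul_inv_pow_lt (K : ℝ) {c : ℝ} (hc : 0 < c) :
    ∃ k : ℕ, 0 < k ∧ ∀ q : ℝ, k ≤ q → ∀ n : ℕ, 0 < n → (K * q⁻¹) ^ n < c := by
  have hε : 0 < min c 1 := by positivity
  obtain ⟨k, hk⟩ := exists_nat_gt (|K| / min c 1)
  have hk0 : (0 : ℝ) < k := lt_of_le_of_lt (by positivity) hk
  refine ⟨k, by exact_mod_cast hk0, fun q hq n hn => ?_⟩
  have hq0 : 0 < q := hk0.trans_le hq
  have habs : |K * q⁻¹| < min c 1 := by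
    rw [abs_mul, abs_inv, abs_of_pos hq0, ← div_eq_mul_inv, div_lt_comm₀ hq0 hε]
    exact hk.trans_le hq
  calc (K * q⁻¹) ^ n ≤ |K * q⁻¹| ^ n := by rw [← abs_pow]; exact le_abs_self _
    _ ≤ |K * q⁻¹| := pow_le_of_le_one (abs_nonneg _) (habs.le.trans (min_le_right _ _)) hn.ne'
    _ < c := habs.trans_le (min_le_left _ _)

namespace QuadraticAlgebra

open GaussianInt

variable {a b : GaussianInt}

/-- The element of `QuadraticAlgebra ℤ[i] a b` obtained by clearing denominators in
`w ^ τ * α ^ (w * t)`, where `w` is a Gaussian integer with coordinates below `M`, `α = A / B` and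
`α ^ I = ω / d`. -/
def gaussianExp (A B d : GaussianInt) (M t τ : ℕ) (w : Fin M × Fin M) :
    QuadraticAlgebra GaussianInt a b :=
  ((⟨(w.1 : ℕ), (w.2 : ℕ)⟩ : GaussianInt) ^ τ *
    (A ^ (t * w.1) * B ^ (t * (M - w.1)) * d ^ (t * (M - w.2)))) • omega ^ (t * (w.2 : ℕ))

theorem l1Norm_gaussianExp_le {A B d : GaussianInt} {E : ℝ} (hE : 1 ≤ E) (hA : A.l1Norm ≤ E)
    (hB : B.l1Norm ≤ E) (hd : d.l1Norm ≤ E) (hab : 1 + a.l1Norm + b.l1Norm ≤ E)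
    (M t τ : ℕ) (w : Fin M × Fin M) :
    l1Norm (gaussianExp A B d M t τ w : QuadraticAlgebra GaussianInt a b) ≤
      (2 * M) ^ τ * E ^ (4 * (t * M)) := by
  have key {x : GaussianInt} (hx : x.l1Norm ≤ E) {n : ℕ} (hn : n ≤ M) :
      (x ^ (t * n)).l1Norm ≤ E ^ (t * M) :=
    (l1Norm_pow_le _ _).trans ((pow_le_pow_left₀ (GaussianInt.l1Norm_nonneg _) hx _).trans
      (pow_le_pow_right₀ hE (Nat.mul_le_mul_left t hn)))
  have hw : GaussianInt.l1Norm (⟨(w.1 : ℕ), (w.2 : ℕ)⟩ ^ τ) ≤ (2 * M) ^ τ := by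
    refine (l1Norm_pow_le _ _).trans (pow_le_pow_left₀ (GaussianInt.l1Norm_nonneg _) ?_ _)
    have h₁ : ((w.1 : ℕ) : ℝ) ≤ M := by exact_mod_cast w.1.2.le
    have h₂ : ((w.2 : ℕ) : ℝ) ≤ M := by exact_mod_cast w.2.2.le
    simp only [GaussianInt.l1Norm, Int.cast_natCast, Nat.abs_cast]
    linarith
  have hω : l1Norm ((omega : QuadraticAlgebra GaussianInt a b) ^ (t * (w.2 : ℕ))) ≤
      E ^ (t * M) := by
    have := GaussianInt.l1Norm_nonneg a
    have := GaussianInt.l1Norm_nonneg b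
    exact (l1Norm_omega_pow_le _).trans ((pow_le_pow_left₀ (by positivity) hab _).trans
      (pow_le_pow_right₀ hE (Nat.mul_le_mul_left t w.2.2.le)))
  have h0 (x : GaussianInt) := GaussianInt.l1Norm_nonneg x
  calc _ ≤ _ := l1Norm_smul_le _ _
    _ ≤ ((2 * M) ^ τ * (E ^ (t * M) * E ^ (t * M) * E ^ (t * M))) * E ^ (t * M) := by
      refine mul_le_mul ?_ hω (l1Norm_nonneg _) (by positivity)
      refine (GaussianInt.l1Norm_mul_le _ _).trans (mul_le_mul hw ?_ (h0 _) (by positivity))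
      refine (GaussianInt.l1Norm_mul_le _ _).trans
        (mul_le_mul ?_ (key hd (Nat.sub_le _ _)) (h0 _) (by positivity))
      exact (GaussianInt.l1Norm_mul_le _ _).trans
        (mul_le_mul (key hA w.1.2.le) (key hB (Nat.sub_le _ _)) (h0 _) (by positivity))
    _ = _ := by ring

theorem pow_mul_evalComplex_gaussianExp {A B d : GaussianInt} {l σ : ℂ}
    (hσ : σ * σ = a + b * σ) (hA : B * exp l = A) (hd : d * exp (I * l) = σ)
    (M t τ : ℕ) (w : Fin M × Fin M) :
    l ^ τ * evalComplex σ hσ (gaussianExp A B d M t τ w) =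
      (B * d : ℂ) ^ (t * M) *
        ((((w.1 : ℕ) + (w.2 : ℕ) * I) * l) ^ τ * exp (((w.1 : ℕ) + (w.2 : ℕ) * I) * l * t)) := by
  obtain ⟨⟨m, hm⟩, ⟨n, hn⟩⟩ := w
  have hexp : exp ((m + n * I) * l * t) = exp l ^ (t * m) * exp (I * l) ^ (t * n) := by
    rw [← exp_nat_mul, ← exp_nat_mul, ← exp_add]
    push_cast
    ring_nf
  have hBM : (B : ℂ) ^ (t * M) = (B : ℂ) ^ (t * m) * (B : ℂ) ^ (t * (M - m)) := by
    rw [← pow_add, ← mul_add, Nat.add_sub_cancel' hm.le]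
  have hdM : (d : ℂ) ^ (t * M) = (d : ℂ) ^ (t * n) * (d : ℂ) ^ (t * (M - n)) := by
    rw [← pow_add, ← mul_add, Nat.add_sub_cancel' hn.le]
  simp only [gaussianExp, evalComplex_smul, map_pow, evalComplex_omega, map_mul, toComplex_def',
    Int.cast_natCast]
  rw [hexp, mul_pow (B : ℂ), hBM, hdM, ← hA, ← hd]
  simp only [mul_pow]
  ring

/-- **Gelfond's theorem** for the exponent `I`, quadratic case: if `exp l` is in `ℚ(i)` and `l ≠ 0`,
then `exp (I * l)` is not quadratic over `ℚ(i)`. -/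
theorem eq_zero_of_exp_of_exp_I_mul {A B d : GaussianInt} {l σ : ℂ}
    (hB0 : B ≠ 0) (hd0 : d ≠ 0) (hσ : σ * σ = a + b * σ) (hA : B * exp l = A)
    (hd : d * exp (I * l) = σ) : l = 0 := by
  by_contra hl
  obtain ⟨c, hc, hliouville⟩ := exists_pos_le_norm_evalComplex_mul_l1Norm hσ
  obtain ⟨E, hE, hAE, hBE, hdE, habE⟩ : ∃ E : ℝ, 1 ≤ E ∧ A.l1Norm ≤ E ∧ B.l1Norm ≤ E ∧
      d.l1Norm ≤ E ∧ 1 + a.l1Norm + b.l1Norm ≤ E := by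
    have h₁ := GaussianInt.l1Norm_nonneg A
    have h₂ := GaussianInt.l1Norm_nonneg B
    have h₃ := GaussianInt.l1Norm_nonneg d
    have h₄ := GaussianInt.l1Norm_nonneg a
    have h₅ := GaussianInt.l1Norm_nonneg b
    exact ⟨1 + A.l1Norm + B.l1Norm + d.l1Norm + a.l1Norm + b.l1Norm, by linarith, by linarith,
      by linarith, by linarith, by linarith⟩
  let K₁ : ℝ := 128 * (128 * (16 * E ^ 224)) * (16 * E ^ 224)
  let K₂ : ℝ := ‖l‖⁻¹ * E ^ 112 * (128 * (128 * (16 * E ^ 224)) * Real.exp (384 * ‖l‖))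
  obtain ⟨k, hk, hsmall⟩ := exists_nat_forall_mul_inv_pow_lt (K₁ * K₂) hc
  let M := 8 * k
  let L := k ^ 2
  let x : Fin 8 × Fin L → Fin M × Fin M → QuadraticAlgebra GaussianInt a b :=
    fun j => gaussianExp A B d M j.1 j.2
  let T : ℝ := (2 * M) ^ L * E ^ (28 * M)
  have hM : (1 : ℝ) ≤ 2 * M := by
    have : (1 : ℝ) ≤ k := by exact_mod_cast hk
    simp only [M]
    push_cast
    linarith
  have hT : 1 ≤ T := one_le_mul_of_one_le_of_one_le (one_le_pow₀ hM) (one_le_pow₀ hE)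
  have hsize (t τ : ℕ) (ht : t < 8) (w : Fin M × Fin M) :
      l1Norm (gaussianExp A B d M t τ w : QuadraticAlgebra GaussianInt a b) ≤
        (2 * M) ^ τ * E ^ (28 * M) := by
    refine (l1Norm_gaussianExp_le hE hAE hBE hdE habE M t τ w).trans ?_
    gcongr 1
    refine pow_le_pow_right₀ hE ?_
    nlinarith
  have : Nonempty (Fin 8 × Fin L) := ⟨⟨0, ⟨0, by positivity⟩⟩⟩
  obtain ⟨C, hC0, hCx, hCT⟩ := exists_ne_zero_sum_zsmul_eq_zero x hT (fun j w => by
    refine (hsize j.1 j.2 j.1.2 w).trans ?_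
    exact mul_le_mul_of_nonneg_right (pow_le_pow_right₀ hM j.2.2.le) (by positivity))
    (by simp [M, L]; ring)
  have hcard : (Fintype.card (Fin M × Fin M) : ℝ) = 64 * k ^ 2 := by
    simp [M]; ring
  let v (t τ : ℕ) : QuadraticAlgebra GaussianInt a b := ∑ w, C w • gaussianExp A B d M t τ w
  let ξ (w : Fin M × Fin M) : ℂ := (w.1 : ℕ) + (w.2 : ℕ) * I
  let G : ℂ → ℂ := fun u => ∑ w, C w * exp (ξ w * l * u)
  have hG : Differentiable ℂ G := by fun_prop
  have hderiv (t τ : ℕ) :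
      l ^ τ * evalComplex σ hσ (v t τ) = (B * d : ℂ) ^ (t * M) * iteratedDeriv τ G t := by
    simp only [v, G, map_sum, map_zsmul, Finset.mul_sum]
    rw [iteratedDeriv_fun_sum (fun i _ => by fun_prop), Finset.mul_sum]
    refine Finset.sum_congr rfl fun w _ => ?_
    rw [iteratedDeriv_const_mul_field, iteratedDeriv_cexp_const_mul]
    rw [zsmul_eq_mul]
    linear_combination (C w : ℂ) * pow_mul_evalComplex_gaussianExp hσ hA hd M t τ w
  have hBd : (B * d : ℂ) ≠ 0 := by simp [hB0, hd0]
  have hex : ∃ ρ, ∃ t < 8, evalComplex σ hσ (v t ρ) ≠ 0 := by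
    by_contra! hall
    have hξ : Function.Injective ξ := fun w w' h => by
      have h₁ := congrArg Complex.re h
      have h₂ := congrArg Complex.im h
      simp [ξ] at h₁ h₂
      exact Prod.ext (Fin.ext h₁) (Fin.ext h₂)
    have := eq_zero_of_forall_sum_mul_pow_eq_zero (c := fun w => (C w : ℂ)) hξ fun τ => by
      have h := hall τ 0 (by norm_num)
      simpa [v, gaussianExp, evalComplex_smul, toComplex_def', ξ, mul_comm] using h
    exact hC0 (funext fun w => by simpa using congrFun this w)
  classical
  obtain ⟨t, ht, hne⟩ := Nat.find_spec hex
  have hmin (n : ℕ) (hn : n < Nat.find hex) (s : ℕ) (hs : s < 8) :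
      evalComplex σ hσ (v s n) = 0 := by
    have := Nat.find_min hex hn
    push Not at this
    exact this s hs
  generalize Nat.find hex = ρ at hne hmin
  have hLρ : L ≤ ρ := by
    by_contra! h
    exact hne (by simpa [v, x] using congrArg (evalComplex σ hσ) (hCx (⟨t, ht⟩, ⟨ρ, h⟩)))
  have hGzero (s : ℕ) (hs : s < 8) (n : ℕ) (hn : n < ρ) : iteratedDeriv n G s = 0 := by
    have := hderiv s n
    rw [hmin n hn s hs, mul_zero, eq_comm] at this
    exact (mul_eq_zero.1 this).resolve_left (pow_ne_zero _ hBd)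
  -- Estimates in terms of `q = √ρ`.
  obtain ⟨q, hkq, hq⟩ : ∃ q : ℝ, k ≤ q ∧ q ^ 2 = ρ :=
    ⟨√ρ, Real.le_sqrt_of_sq_le (by exact_mod_cast hLρ), Real.sq_sqrt (Nat.cast_nonneg _)⟩
  have hk1 : (1 : ℝ) ≤ k := by exact_mod_cast hk
  have hq1 : 1 ≤ q := hk1.trans hkq
  have hq0 : 0 < q := by linarith
  have hqρ : q ≤ ρ := by rw [← hq]; nlinarith
  have hρ0 : 0 < ρ := lt_of_lt_of_le (by positivity) hLρ
  have hkρ : k ≤ ρ := by exact_mod_cast hkq.trans hqρ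
  have hMq : 2 * (M : ℝ) ≤ 16 * q := by simp only [M]; push_cast; linarith
  have hMρ : M ≤ 8 * ρ := by omega
  have hN : (64 * k ^ 2 : ℝ) ≤ 128 ^ ρ := by
    have h₁ : (ρ : ℝ) ≤ 2 ^ ρ := by exact_mod_cast (Nat.lt_two_pow_self).le
    have h₂ : (64 : ℝ) ≤ 64 ^ ρ := le_self_pow₀ (by norm_num) hρ0.ne'
    calc (64 * k ^ 2 : ℝ) ≤ 64 * ρ := by rw [← hq]; gcongr
      _ ≤ 64 ^ ρ * 2 ^ ρ := by gcongr
      _ = 128 ^ ρ := by rw [← mul_pow]; norm_num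
  have hE28 : E ^ (28 * M) ≤ (E ^ 224) ^ ρ := by
    rw [← pow_mul]
    exact pow_le_pow_right₀ hE (by omega)
  have hMτ : (2 * M : ℝ) ^ ρ ≤ (16 * q) ^ ρ := by gcongr
  have hTρ : T ≤ (16 * q * E ^ 224) ^ ρ := by
    rw [mul_pow]
    refine mul_le_mul ?_ hE28 (by positivity) (by positivity)
    exact (pow_le_pow_right₀ hM hLρ).trans hMτ
  have hCρ (w) : |(C w : ℝ)| ≤ (128 * (16 * q * E ^ 224)) ^ ρ := by
    refine (hCT w).trans ?_
    rw [hcard, mul_pow]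
    gcongr
  have hvsize : l1Norm (v t ρ) ≤ (K₁ * q ^ 2) ^ ρ := by
    calc l1Norm (v t ρ) ≤ ∑ w, l1Norm (C w • gaussianExp A B d M t ρ w :
            QuadraticAlgebra GaussianInt a b) := l1Norm_sum_le _ _
      _ ≤ ∑ w : Fin M × Fin M,
          (128 * (16 * q * E ^ 224)) ^ ρ * ((16 * q) ^ ρ * (E ^ 224) ^ ρ) := by
        refine Finset.sum_le_sum fun w _ => ?_
        rw [l1Norm_zsmul]
        refine mul_le_mul (hCρ w) ((hsize t ρ ht w).trans ?_) (l1Norm_nonneg _) (by positivity)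
        gcongr
      _ ≤ 128 ^ ρ * ((128 * (16 * q * E ^ 224)) ^ ρ * ((16 * q) ^ ρ * (E ^ 224) ^ ρ)) := by
        rw [Finset.sum_const, nsmul_eq_mul, Finset.card_univ, hcard]
        gcongr
      _ = (K₁ * q ^ 2) ^ ρ := by
        simp only [← mul_pow, K₁]
        ring_nf
  have hGbound (u : ℂ) (hu : ‖u‖ = 8 + 16 * q) :
      ‖G u‖ ≤ (128 * (128 * (16 * q * E ^ 224)) * Real.exp (384 * ‖l‖)) ^ ρ := by
    have hterm (w : Fin M × Fin M) : ‖exp (ξ w * l * u)‖ ≤ Real.exp (384 * ‖l‖) ^ ρ := by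
      rw [← Real.exp_nat_mul]
      refine (norm_exp_le_exp_norm _).trans (Real.exp_le_exp.2 ?_)
      have hξM : ‖ξ w‖ ≤ 16 * q := by
        have h₁ : ((w.1 : ℕ) : ℝ) ≤ M := by exact_mod_cast w.1.2.le
        have h₂ : ((w.2 : ℕ) : ℝ) ≤ M := by exact_mod_cast w.2.2.le
        refine (norm_add_le _ _).trans ?_
        simp only [norm_mul, _root_.norm_natCast, norm_I, mul_one]
        linarith
      rw [norm_mul, norm_mul, hu]
      calc _ ≤ 16 * q * ‖l‖ * (24 * q) := by gcongr; linarith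
        _ = ρ * (384 * ‖l‖) := by rw [← hq]; ring
    calc ‖G u‖ ≤ ∑ w : Fin M × Fin M,
          (128 * (16 * q * E ^ 224)) ^ ρ * Real.exp (384 * ‖l‖) ^ ρ := by
          refine (norm_sum_le _ _).trans (Finset.sum_le_sum fun w _ => ?_)
          rw [norm_mul, Complex.norm_intCast]
          exact mul_le_mul (hCρ w) (hterm w) (norm_nonneg _) (by positivity)
      _ ≤ 128 ^ ρ * ((128 * (16 * q * E ^ 224)) ^ ρ * Real.exp (384 * ‖l‖) ^ ρ) := by
        rw [Finset.sum_const, nsmul_eq_mul, Finset.card_univ, hcard]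
        gcongr
      _ = _ := by
        simp only [← mul_pow]
        ring_nf
  have hschwarz : ‖iteratedDeriv ρ G t‖ ≤ (q ^ 2) ^ ρ * (((q ^ 8)⁻¹) ^ ρ *
      (128 * (128 * (16 * q * E ^ 224)) * Real.exp (384 * ‖l‖)) ^ ρ) := by
    refine (norm_iteratedDeriv_le_of_forall_iteratedDeriv_eq_zero hG hGzero
      (R := 8 + 16 * q) (by push_cast; linarith) hGbound ht).trans ?_
    have h₁ : (ρ.factorial : ℝ) ≤ (q ^ 2) ^ ρ := by
      rw [hq]
      exact_mod_cast Nat.factorial_le_pow ρ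
    have h₂ : (2 * (8 : ℕ) / (8 + 16 * q - (8 : ℕ)) : ℝ) ^ (8 * ρ) = ((q ^ 8)⁻¹) ^ ρ := by
      rw [pow_mul]
      congr 1
      push_cast
      field_simp
      ring
    rw [h₂]
    gcongr
  have hvalue : ‖evalComplex σ hσ (v t ρ)‖ ≤ (K₂ * (q ^ 5)⁻¹) ^ ρ := by
    have hBdE : ‖(B * d : ℂ) ^ (t * M)‖ ≤ (E ^ 112) ^ ρ := by
      rw [norm_pow, norm_mul, ← pow_mul]
      calc _ ≤ (E * E) ^ (t * M) := by
            gcongr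
            · exact (norm_toComplex_le B).trans hBE
            · exact (norm_toComplex_le d).trans hdE
        _ = E ^ (2 * (t * M)) := by rw [← pow_two, ← pow_mul]
        _ ≤ _ := pow_le_pow_right₀ hE (by nlinarith)
    have heq : evalComplex σ hσ (v t ρ) =
        (l ^ ρ)⁻¹ * ((B * d : ℂ) ^ (t * M) * iteratedDeriv ρ G t) := by
      rw [← hderiv, inv_mul_cancel_left₀ (pow_ne_zero _ hl)]
    rw [heq, norm_mul, norm_mul, norm_inv, norm_pow, ← inv_pow]
    calc _ ≤ ‖l‖⁻¹ ^ ρ * ((E ^ 112) ^ ρ * ((q ^ 2) ^ ρ * (((q ^ 8)⁻¹) ^ ρ *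
          (128 * (128 * (16 * q * E ^ 224)) * Real.exp (384 * ‖l‖)) ^ ρ))) := by gcongr
      _ = _ := by
        simp only [← mul_pow, K₂]
        congr 1
        field_simp
  have hfinal : c ≤ (K₁ * K₂ * (q ^ 3)⁻¹) ^ ρ :=
    calc c ≤ _ := hliouville _ hne
      _ ≤ (K₂ * (q ^ 5)⁻¹) ^ ρ * (K₁ * q ^ 2) ^ ρ := by
        gcongr
        exact l1Norm_nonneg _
      _ = _ := by
        rw [← mul_pow]
        congr 1
        field_simp
  have hq3 : (k : ℝ) ≤ q ^ 3 := hkq.trans (le_self_pow₀ hq1 (by norm_num))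
  exact absurd hfinal (hsmall _ hq3 ρ hρ0).not_ge

end QuadraticAlgebra

theorem Real.irrational_cos_log {a : ℚ} (ha : 0 < a) (ha1 : a ≠ 1) :
    Irrational (Real.cos (Real.log a)) := by
  rintro ⟨r, hr⟩
  have haR : (0 : ℝ) < a := by exact_mod_cast ha
  have hexp : Complex.exp (Real.log a : ℝ) = a := by
    rw [← Complex.ofReal_exp, Real.exp_log haR]
    simp
  have hcos : Complex.exp (I * (Real.log a : ℝ)) * Complex.exp (I * (Real.log a : ℝ)) + 1 =
      2 * r * Complex.exp (I * (Real.log a : ℝ)) := by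
    have h₁ : (r : ℂ) = Complex.cos (Real.log a : ℝ) := by
      rw [← Complex.ofReal_cos, ← hr]
      simp
    rw [h₁, Complex.two_cos, add_mul, ← Complex.exp_add, ← Complex.exp_add, ← Complex.exp_add]
    simp [mul_comm]
  have hrd : (r : ℂ) * r.den = r.num := by exact_mod_cast Rat.mul_den_eq_num r
  have hl : ((Real.log a : ℝ) : ℂ) = 0 :=
    QuadraticAlgebra.eq_zero_of_exp_of_exp_I_mul (a := -(r.den : GaussianInt) ^ 2)
      (b := ((2 * r.num : ℤ) : GaussianInt)) (A := (a.num : GaussianInt)) (B := (a.den : GaussianInt))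
      (d := (r.den : GaussianInt)) (by simp) (by simp)
      (by simp [map_ofNat GaussianInt.toComplex 2]; linear_combination (r.den : ℂ) ^ 2 * hcos +
            2 * r.den * Complex.exp (I * (Real.log a : ℝ)) * hrd)
      (by rw [hexp]; simp; exact_mod_cast Rat.den_mul_eq_num a) rfl
  have h₀ : Real.log a = 0 := by exact_mod_cast hl
  have h₁ := Real.eq_one_of_pos_of_log_eq_zero haR h₀
  exact ha1 (by exact_mod_cast h₁)

theorem Nat.Coprime.eq_one_of_zpow_eq_zpow {x z : ℕ} (h : Nat.Coprime x z) (hx : 0 < x)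
    (hz : 0 < z) {p r : ℤ} (hp : p ≠ 0) (heq : (x : ℚ) ^ p = (z : ℚ) ^ r) : x = 1 := by
  have hx0 : (x : ℚ) ≠ 0 := by positivity
  have hz0 : (z : ℚ) ≠ 0 := by positivity
  have hpow : x ^ p.natAbs = z ^ r.natAbs ∨ x ^ p.natAbs * z ^ r.natAbs = 1 := by
    rcases Int.natAbs_eq p with h₁ | h₁ <;> rcases Int.natAbs_eq r with h₂ | h₂ <;>
      rw [h₁, h₂] at heq <;> simp only [zpow_neg, zpow_natCast] at heq
    · exact Or.inl (by exact_mod_cast heq)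
    · rw [← mul_eq_one_iff_eq_inv₀ (by positivity)] at heq
      exact Or.inr (by exact_mod_cast heq)
    · rw [inv_eq_iff_eq_inv, ← mul_eq_one_iff_eq_inv₀ (by positivity)] at heq
      exact Or.inr (by exact_mod_cast heq)
    · exact Or.inl (by exact_mod_cast inv_injective heq)
  have hone : x ^ p.natAbs = 1 := by
    rcases hpow with hpow | hpow
    · have := Nat.Coprime.pow p.natAbs r.natAbs h
      rwa [← hpow, Nat.coprime_self] at this
    · exact Nat.eq_one_of_mul_eq_one_right hpow
  exact (Nat.pow_eq_one.1 hone).resolve_right (by simpa using hp)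

theorem Complex.natCast_cpow_two_add_mul_I {n : ℕ} (hn : 0 < n) (p : ℤ) :
    (n : ℂ) ^ ((2 : ℂ) + (p : ℂ) * I) = n ^ 2 * exp ((p * Real.log n : ℝ) * I) := by
  have hn0 : (n : ℂ) ≠ 0 := by exact_mod_cast hn.ne'
  rw [cpow_add _ _ hn0, cpow_def_of_ne_zero hn0 ((p : ℂ) * I), ← natCast_log]
  congr 1
  · exact_mod_cast cpow_natCast (n : ℂ) 2
  · push_cast
    ring_nf

/-- The first base of a solution is `1`, by the law of cosines. -/
theorem eq_one_of_cpow_add_cpow_eq {x y z : ℕ} (hx : 0 < x) (hy : 0 < y) (hz : 0 < z)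
    (hxz : Nat.Coprime x z) {p q r : ℤ} (hp : p ≠ 0)
    (h : (x : ℂ) ^ ((2 : ℂ) + (p : ℂ) * I) + (y : ℂ) ^ ((2 : ℂ) + (q : ℂ) * I) =
      (z : ℂ) ^ ((2 : ℂ) + (r : ℂ) * I)) : x = 1 := by
  refine hxz.eq_one_of_zpow_eq_zpow hx hz hp (r := r) ?_
  by_contra hne
  have hxR : (0 : ℝ) < x := by exact_mod_cast hx
  have hzR : (0 : ℝ) < z := by exact_mod_cast hz
  have hxQ : (0 : ℚ) < x := by exact_mod_cast hx
  have hzQ : (0 : ℚ) < z := by exact_mod_cast hz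
  have hirr := Real.irrational_cos_log (a := (x : ℚ) ^ p / (z : ℚ) ^ r) (by positivity) (by
    rwa [Ne, div_eq_one_iff_eq (by positivity)])
  have hlog : Real.log ((x : ℚ) ^ p / (z : ℚ) ^ r : ℚ) = p * Real.log x - r * Real.log z := by
    push_cast
    rw [Real.log_div (by positivity) (by positivity), Real.log_zpow, Real.log_zpow]
  rw [hlog, Real.cos_sub] at hirr
  simp only [natCast_cpow_two_add_mul_I hx, natCast_cpow_two_add_mul_I hy,
    natCast_cpow_two_add_mul_I hz, exp_mul_I, ← ofReal_cos, ← ofReal_sin] at h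
  generalize (p * Real.log x : ℝ) = α at h hirr
  generalize (q * Real.log y : ℝ) = β at h
  generalize (r * Real.log z : ℝ) = γ at h hirr
  have hre := congrArg re h
  have him := congrArg im h
  simp [← ofReal_natCast, ← ofReal_pow, -ofReal_cos, -ofReal_sin] at hre him
  refine hirr ⟨(x ^ 4 + z ^ 4 - y ^ 4) / (2 * x ^ 2 * z ^ 2), ?_⟩
  push_cast
  rw [div_eq_iff (by positivity)]
  have hα := Real.sin_sq_add_cos_sq α
  have hβ := Real.sin_sq_add_cos_sq β
  have hγ := Real.sin_sq_add_cos_sq γ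
  have h₁ : (y : ℝ) ^ 2 * Real.cos β = z ^ 2 * Real.cos γ - x ^ 2 * Real.cos α := by linarith
  have h₂ : (y : ℝ) ^ 2 * Real.sin β = z ^ 2 * Real.sin γ - x ^ 2 * Real.sin α := by linarith
  have h₃ := congrArg (· ^ 2) h₁
  have h₄ := congrArg (· ^ 2) h₂
  beta_reduce at h₃ h₄
  linear_combination (y : ℝ) ^ 4 * hβ - x ^ 4 * hα - z ^ 4 * hγ - h₃ - h₄

theorem stmt_12 (x y z : ℕ) (hx : 0 < x) (hy : 0 < y) (hz : 0 < z)
    (hxy : Nat.Coprime x y) (hxz : Nat.Coprime x z) (hyz : Nat.Coprime y z)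
    (p q r : ℤ) (hpq : p * q ≠ 0) :
    (x : ℂ) ^ ((2 : ℂ) + (p : ℂ) * Complex.I) + (y : ℂ) ^ ((2 : ℂ) + (q : ℂ) * Complex.I) ≠
      (z : ℂ) ^ ((2 : ℂ) + (r : ℂ) * Complex.I) := by
  intro h
  obtain rfl := eq_one_of_cpow_add_cpow_eq hx hy hz hxz (left_ne_zero_of_mul hpq) h
  obtain rfl := eq_one_of_cpow_add_cpow_eq hy hx hz hyz (right_ne_zero_of_mul hpq)
    (add_comm _ _ |>.trans h)
  have hnorm := congrArg norm h
  rw [natCast_cpow_two_add_mul_I hz, norm_mul, norm_exp_ofReal_mul_I] at hnorm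
  norm_num at hnorm
  have h2 : 2 = z ^ 2 := by exact_mod_cast hnorm
  have : z < 2 := by nlinarith
  interval_cases z
  omega
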